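/- Let L be a finitely generated ℰ-module with an ℰ-valued Hermitian form ⟨·,·⟩ (linear in the first variable, conjugate-linear in the second, ⟨y,x⟩ = conj(⟨x,y⟩)) satisfying ⟨x,y⟩ ∈ θℰ for all x, y ∈ L. Then the map sending (v,w) to the image of (1/θ)·⟨v,w⟩ under the quotient map ℰ → ℰ/θℰ ≅ 𝔽₃ descends to a well-defined 𝔽₃-bilinear alternating form (·,·) on the 𝔽₃-vector space L/θL (in particular (v̄,v̄) = 0 for all v). Moreover, for L = Λ₁₀ this form on Λ₁₀/θΛ₁₀ is nondegenerate. -/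

import Mathlib

noncomputable section

set_option synthInstance.maxHeartbeats 1000000
set_option maxHeartbeats 1000000

/-- The primitive cube root of unity `ω = e^{2πi/3}`. -/
def ω : ℂ := ⟨-1/2, Real.sqrt 3 / 2⟩

/-- `θ = ω - ω̄`, a square root of `-3`. -/
def θ : ℂ := ω - (starRingEnd ℂ) ω

/-- The ring of Eisenstein integers `ℰ = ℤ[ω]` as a subring of ℂ. -/
def Eis : Subring ℂ := Subring.closure {ω}

lemma omega_re : ω.re = -1/2 := rfl
lemma omega_im : ω.im = Real.sqrt 3 / 2 := rfl

lemma conj_omega : (starRingEnd ℂ) ω = -1 - ω := by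
  apply Complex.ext
  · rw [Complex.conj_re, Complex.sub_re, Complex.neg_re, Complex.one_re, omega_re]
    norm_num
  · rw [Complex.conj_im, Complex.sub_im, Complex.neg_im, Complex.one_im, omega_im]
    norm_num

lemma theta_mem : θ ∈ Eis := by
  have hθ : θ = 1 + (ω + ω) := by
    unfold θ
    rw [conj_omega]
    ring
  rw [hθ]
  exact add_mem (one_mem _)
    (add_mem (Subring.subset_closure rfl) (Subring.subset_closure rfl))

/-- `θ` as an element of `ℰ`. -/
def θE : Eis := ⟨θ, theta_mem⟩

/-- The Gram matrix of `E₈^ℰ`. -/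
def Bmat : Matrix (Fin 4) (Fin 4) ℂ :=
  !![3, θ, 0, 0; -θ, 3, θ, 0; 0, -θ, 3, θ; 0, 0, -θ, 3]

/-- The Gram matrix of the hyperbolic cell `H`. -/
def Cmat : Matrix (Fin 2) (Fin 2) ℂ := !![0, θ; -θ, 0]

/-- The Gram matrix of `Λ₁₀`: block diagonal with blocks B, B, C. -/
def Lam10 : Matrix (Fin 10) (Fin 10) ℂ := Matrix.of fun i j =>
  if h : i.val < 4 ∧ j.val < 4 then Bmat ⟨i.val, h.1⟩ ⟨j.val, h.2⟩
  else if h : 4 ≤ i.val ∧ i.val < 8 ∧ 4 ≤ j.val ∧ j.val < 8 then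
    Bmat ⟨i.val - 4, by omega⟩ ⟨j.val - 4, by omega⟩
  else if h : 8 ≤ i.val ∧ 8 ≤ j.val then
    Cmat ⟨i.val - 8, by have := i.isLt; omega⟩ ⟨j.val - 8, by have := j.isLt; omega⟩
  else 0

/-- The Hermitian form of `Λ₁₀ = ℰ¹⁰`. -/
def herm10E (x y : Fin 10 → Eis) : ℂ :=
  ∑ i : Fin 10, ∑ j : Fin 10, Lam10 i j * (x i : ℂ) * (starRingEnd ℂ) ((y j : ℂ))

lemma theta_eq : θ = 1 + 2 * ω := by
  unfold θ
  rw [conj_omega]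
  ring

lemma omega_sq : ω * ω = -1 - ω := by
  have h3 : Real.sqrt 3 * Real.sqrt 3 = 3 := Real.mul_self_sqrt (by norm_num)
  apply Complex.ext
  · simp only [Complex.mul_re, omega_re, omega_im, Complex.sub_re, Complex.neg_re, Complex.one_re]
    linarith
  · simp only [Complex.mul_im, omega_re, omega_im, Complex.sub_im, Complex.neg_im, Complex.one_im]
    linarith

lemma theta_sq : θ * θ = -3 := by
  rw [theta_eq]
  linear_combination 4 * omega_sq

lemma theta_ne_zero : θ ≠ 0 := by
  intro h
  have h3 := theta_sq
  rw [h] at h3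
  norm_num at h3

lemma conj_theta : (starRingEnd ℂ) θ = -θ := by
  simp [θ]

lemma omega_mem : ω ∈ Eis := Subring.subset_closure rfl

/-- Every Eisenstein integer has the form `a + b ω` with `a, b ∈ ℤ`. -/
lemma exists_int_add_int_mul_omega {z : ℂ} (hz : z ∈ Eis) : ∃ a b : ℤ, z = a + b * ω := by
  unfold Eis at hz
  induction hz using Subring.closure_induction with
  | mem x hx => exact ⟨0, 1, by simpa using hx⟩
  | zero => exact ⟨0, 0, by simp⟩
  | one => exact ⟨1, 0, by simp⟩
  | add x y _ _ hx hy =>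
    obtain ⟨a, b, rfl⟩ := hx
    obtain ⟨c, d, rfl⟩ := hy
    exact ⟨a + c, b + d, by push_cast; ring⟩
  | neg x _ hx =>
    obtain ⟨a, b, rfl⟩ := hx
    exact ⟨-a, -b, by push_cast; ring⟩
  | mul x y _ _ hx hy =>
    obtain ⟨a, b, rfl⟩ := hx
    obtain ⟨c, d, rfl⟩ := hy
    exact ⟨a * c - b * d, a * d + b * c - b * d, by
      push_cast; linear_combination (b * d : ℂ) * omega_sq⟩

lemma conj_mem_Eis {z : ℂ} (hz : z ∈ Eis) : (starRingEnd ℂ) z ∈ Eis := by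
  obtain ⟨a, b, rfl⟩ := exists_int_add_int_mul_omega hz
  simp only [map_add, map_mul, map_intCast, conj_omega]
  exact add_mem (intCast_mem _ a)
    (mul_mem (intCast_mem _ b) (sub_mem (neg_mem (one_mem _)) omega_mem))

/-- The ideal `θℰ`, as an additive subgroup of `ℂ`. -/
def thetaMultiples : AddSubgroup ℂ := Eis.toAddSubgroup.map (AddMonoidHom.mulLeft θ)

lemma mem_thetaMultiples {z : ℂ} : z ∈ thetaMultiples ↔ ∃ m : Eis, z = θ * (m : ℂ) := by
  constructor
  · rintro ⟨m, hm, rfl⟩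
    exact ⟨⟨m, hm⟩, rfl⟩
  · rintro ⟨m, rfl⟩
    exact ⟨m, m.2, rfl⟩

lemma theta_mul_mem {z : ℂ} (hz : z ∈ Eis) : θ * z ∈ thetaMultiples := ⟨z, hz, rfl⟩

lemma conj_mem_thetaMultiples {z : ℂ} (hz : z ∈ thetaMultiples) :
    (starRingEnd ℂ) z ∈ thetaMultiples := by
  obtain ⟨m, rfl⟩ := mem_thetaMultiples.1 hz
  rw [map_mul, conj_theta, neg_mul]
  exact neg_mem (theta_mul_mem (conj_mem_Eis m.2))

lemma exists_int_sub_mem {z : ℂ} (hz : z ∈ Eis) : ∃ n : ℤ, z - n ∈ thetaMultiples := by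
  obtain ⟨a, b, rfl⟩ := exists_int_add_int_mul_omega hz
  refine ⟨a + b, ?_⟩
  have hm : (a + b * ω - ((a + b : ℤ) : ℂ)) = θ * (b * (1 + ω)) := by
    rw [theta_eq]
    push_cast
    linear_combination (-2 * b : ℂ) * omega_sq
  rw [hm]
  exact theta_mul_mem (mul_mem (intCast_mem _ b) (add_mem (one_mem _) omega_mem))

lemma three_mem : (3 : ℂ) ∈ thetaMultiples := by
  have h3 : (3 : ℂ) = -(θ * θ) := by rw [theta_sq, neg_neg]
  rw [h3]
  exact neg_mem (theta_mul_mem theta_mem)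

/-- The intersection of `θℰ` with `ℤ` is `3ℤ`. -/
lemma intCast_mem_thetaMultiples {n : ℤ} : (n : ℂ) ∈ thetaMultiples ↔ (n : ZMod 3) = 0 := by
  rw [ZMod.intCast_zmod_eq_zero_iff_dvd]
  constructor
  · intro hn
    obtain ⟨m, hm⟩ := mem_thetaMultiples.1 hn
    obtain ⟨a, b, hab⟩ := exists_int_add_int_mul_omega m.2
    have key : (n : ℂ) = ((a - 2 * b : ℤ) : ℂ) + ((2 * a - b : ℤ) : ℂ) * ω := by
      rw [hm, hab, theta_eq]
      push_cast
      linear_combination (2 * b : ℂ) * omega_sq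
    have him := congrArg Complex.im key
    rw [Complex.add_im, Complex.mul_im, omega_im, Complex.intCast_im, Complex.intCast_im,
      Complex.intCast_im, Complex.intCast_re, zero_mul, add_zero, zero_add] at him
    have hs : Real.sqrt 3 / 2 ≠ 0 := by positivity
    have hb : 2 * a - b = 0 := by
      exact_mod_cast (mul_eq_zero.1 him.symm).resolve_right hs
    rw [hb, Int.cast_zero, zero_mul, add_zero] at key
    have hn' : n = a - 2 * b := by exact_mod_cast key
    exact ⟨-a, by push_cast; lia⟩
  · rintro ⟨k, rfl⟩
    push_cast
    rw [mul_comm, ← zsmul_eq_mul]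
    exact zsmul_mem three_mem k

open Classical in
/-- The reduction map `ℰ → ℰ/θℰ ≅ 𝔽₃`, extended by zero to `ℂ`. -/
def thetaResidue (z : ℂ) : ZMod 3 :=
  if hz : ∃ n : ℤ, z - n ∈ thetaMultiples then (hz.choose : ZMod 3) else 0

lemma thetaResidue_eq {z : ℂ} {n : ℤ} (hn : z - n ∈ thetaMultiples) :
    thetaResidue z = n := by
  have hz : ∃ n : ℤ, z - n ∈ thetaMultiples := ⟨n, hn⟩
  rw [thetaResidue, dif_pos hz, ← sub_eq_zero, ← Int.cast_sub, ← intCast_mem_thetaMultiples]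
  have := sub_mem hn hz.choose_spec
  push_cast
  rwa [sub_sub_sub_cancel_left] at this

lemma thetaResidue_add {x y : ℂ} (hx : x ∈ Eis) (hy : y ∈ Eis) :
    thetaResidue (x + y) = thetaResidue x + thetaResidue y := by
  obtain ⟨n, hn⟩ := exists_int_sub_mem hx
  obtain ⟨k, hk⟩ := exists_int_sub_mem hy
  rw [thetaResidue_eq hn, thetaResidue_eq hk, ← Int.cast_add]
  apply thetaResidue_eq
  push_cast
  rw [add_sub_add_comm]
  exact add_mem hn hk

lemma thetaResidue_of_mem {z : ℂ} (hz : z ∈ thetaMultiples) : thetaResidue z = 0 := by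
  simpa using thetaResidue_eq (n := 0) (by simpa using hz)

lemma thetaResidue_of_conj_eq_neg {z : ℂ} (hz : z ∈ Eis) (hc : (starRingEnd ℂ) z = -z) :
    thetaResidue z = 0 := by
  obtain ⟨n, hn⟩ := exists_int_sub_mem hz
  have h2 : ((2 * n : ℤ) : ℂ) ∈ thetaMultiples := by
    have := neg_mem (add_mem hn (conj_mem_thetaMultiples hn))
    rw [map_sub, hc, map_intCast] at this
    convert this using 1
    push_cast
    ring
  rw [intCast_mem_thetaMultiples] at h2
  rw [thetaResidue_eq hn]
  push_cast at h2
  generalize (n : ZMod 3) = k at h2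
  revert k
  decide

lemma herm10E_single (v : Fin 10 → Eis) (j : Fin 10) :
    herm10E v (Pi.single j 1) = ∑ i, Lam10 i j * (v i : ℂ) := by
  unfold herm10E
  refine Finset.sum_congr rfl fun i _ => ?_
  rw [Finset.sum_eq_single j]
  · simp
  · intro k _ hk
    simp [Pi.single_eq_of_ne hk]
  · simp

/-- A vector of `Λ₁₀` whose products with the standard basis all lie in `θ²ℰ` is a multiple
of `θ`, coordinatewise. -/
lemma coord_mem_thetaMultiples {v : Fin 10 → Eis}
    (hv : ∀ (j : Fin 10) (e : Eis), herm10E v (Pi.single j 1) = θ * (e : ℂ) →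
      (e : ℂ) ∈ thetaMultiples) (i : Fin 10) : (v i : ℂ) ∈ thetaMultiples := by
  have ht (k : Fin 10) : θ * (v k : ℂ) ∈ thetaMultiples := theta_mul_mem (v k).2
  have h0 := hv 0 (-θE * v 0 - v 1) (by
    rw [herm10E_single]
    simp [Fin.sum_univ_succ, Lam10, Bmat, Cmat, θE]
    linear_combination (v 0 : ℂ) * theta_sq)
  push_cast [θE] at h0
  have h1 := hv 1 (v 0 - θE * v 1 - v 2) (by
    rw [herm10E_single]
    simp [Fin.sum_univ_succ, Lam10, Bmat, Cmat, θE]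
    linear_combination (v 1 : ℂ) * theta_sq)
  push_cast [θE] at h1
  have h2 := hv 2 (v 1 - θE * v 2 - v 3) (by
    rw [herm10E_single]
    simp [Fin.sum_univ_succ, Lam10, Bmat, Cmat, θE]
    linear_combination (v 2 : ℂ) * theta_sq)
  push_cast [θE] at h2
  have h3 := hv 3 (v 2 - θE * v 3) (by
    rw [herm10E_single]
    simp [Fin.sum_univ_succ, Lam10, Bmat, Cmat, θE]
    linear_combination (v 3 : ℂ) * theta_sq)
  push_cast [θE] at h3
  have h4 := hv 4 (-θE * v 4 - v 5) (by
    rw [herm10E_single]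
    simp [Fin.sum_univ_succ, Lam10, Bmat, Cmat, θE]
    linear_combination (v 4 : ℂ) * theta_sq)
  push_cast [θE] at h4
  have h5 := hv 5 (v 4 - θE * v 5 - v 6) (by
    rw [herm10E_single]
    simp [Fin.sum_univ_succ, Lam10, Bmat, Cmat, θE]
    linear_combination (v 5 : ℂ) * theta_sq)
  push_cast [θE] at h5
  have h6 := hv 6 (v 5 - θE * v 6 - v 7) (by
    rw [herm10E_single]
    simp [Fin.sum_univ_succ, Lam10, Bmat, Cmat, θE]
    linear_combination (v 6 : ℂ) * theta_sq)
  push_cast [θE] at h6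
  have h7 := hv 7 (v 6 - θE * v 7) (by
    rw [herm10E_single]
    simp [Fin.sum_univ_succ, Lam10, Bmat, Cmat, θE]
    linear_combination (v 7 : ℂ) * theta_sq)
  push_cast [θE] at h7
  have h8 := hv 8 (-v 9) (by
    rw [herm10E_single]
    simp [Fin.sum_univ_succ, Lam10, Bmat, Cmat])
  push_cast at h8
  have h9 := hv 9 (v 8) (by
    rw [herm10E_single]
    simp [Fin.sum_univ_succ, Lam10, Bmat, Cmat])
  have c1 : (v 1 : ℂ) ∈ thetaMultiples := by
    convert neg_mem (add_mem h0 (ht 0)) using 1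
    ring
  have c2 : (v 2 : ℂ) ∈ thetaMultiples := by
    convert add_mem h3 (ht 3) using 1
    ring
  have c0 : (v 0 : ℂ) ∈ thetaMultiples := by
    convert add_mem (add_mem h1 (ht 1)) c2 using 1
    ring
  have c3 : (v 3 : ℂ) ∈ thetaMultiples := by
    convert sub_mem c1 (add_mem h2 (ht 2)) using 1
    ring
  have c5 : (v 5 : ℂ) ∈ thetaMultiples := by
    convert neg_mem (add_mem h4 (ht 4)) using 1
    ring
  have c6 : (v 6 : ℂ) ∈ thetaMultiples := by
    convert add_mem h7 (ht 7) using 1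
    ring
  have c4 : (v 4 : ℂ) ∈ thetaMultiples := by
    convert add_mem (add_mem h5 (ht 5)) c6 using 1
    ring
  have c7 : (v 7 : ℂ) ∈ thetaMultiples := by
    convert sub_mem c5 (add_mem h6 (ht 6)) using 1
    ring
  have c9 : (v 9 : ℂ) ∈ thetaMultiples := by simpa using h8
  fin_cases i
  exacts [c0, c1, c2, c3, c4, c5, c6, c7, h9, c9]

/-- For a finitely generated `ℰ`-module `L` with an `ℰ`-valued Hermitian
form whose values lie in `θℰ`, the assignment `(v,w) ↦ (1/θ)⟨v,w⟩ mod θℰ` gives a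
well-defined `𝔽₃`-bilinear alternating form on `L/θL` (encoded below by a map
`f : L → L → ZMod 3` which computes the residue class, descends mod `θL`, is additive
in each variable, and is alternating).  Moreover, for `L = Λ₁₀`, any such form is
nondegenerate: if `f v w = 0` for all `w`, then `v ∈ θΛ₁₀`. -/
theorem stmt_12 (L : Type*) [AddCommGroup L] [Module Eis L] [Module.Finite Eis L]
    (h : L → L → ℂ)
    (hval : ∀ x y : L, h x y ∈ Eis)
    (haddl : ∀ x x' y : L, h (x + x') y = h x y + h x' y)
    (haddr : ∀ x y y' : L, h x (y + y') = h x y + h x y')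
    (hsmul : ∀ (e : Eis) (x y : L), h (e • x) y = (e : ℂ) * h x y)
    (hconj : ∀ x y : L, h y x = (starRingEnd ℂ) (h x y))
    (hθ : ∀ x y : L, ∃ e : Eis, h x y = θ * (e : ℂ)) :
    (∃ f : L → L → ZMod 3,
      (∀ (v w : L) (e : Eis), h v w = θ * (e : ℂ) →
        ∃ n : ℤ, (n : ZMod 3) = f v w ∧ ∃ m : Eis, (e : ℂ) - (n : ℂ) = θ * (m : ℂ)) ∧
      (∀ v v' w : L, (∃ u : L, v = v' + θE • u) → f v w = f v' w) ∧
      (∀ v w w' : L, (∃ u : L, w = w' + θE • u) → f v w = f v w') ∧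
      (∀ v v' w : L, f (v + v') w = f v w + f v' w) ∧
      (∀ v w w' : L, f v (w + w') = f v w + f v w') ∧
      (∀ v : L, f v v = 0)) ∧
    (∀ f : (Fin 10 → Eis) → (Fin 10 → Eis) → ZMod 3,
      (∀ (v w : Fin 10 → Eis) (e : Eis), herm10E v w = θ * (e : ℂ) →
        ∃ n : ℤ, (n : ZMod 3) = f v w ∧ ∃ m : Eis, (e : ℂ) - (n : ℂ) = θ * (m : ℂ)) →
      ∀ v : Fin 10 → Eis, (∀ w, f v w = 0) → ∃ u : Fin 10 → Eis, v = θE • u) := by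
  have hdiv (x y : L) : h x y / θ ∈ Eis := by
    obtain ⟨e, he⟩ := hθ x y
    rw [he, mul_div_cancel_left₀ _ theta_ne_zero]
    exact e.2
  have hmem (x y : L) : h x y ∈ thetaMultiples := mem_thetaMultiples.2 (hθ x y)
  have hadd₁ (v v' w : L) :
      thetaResidue (h (v + v') w / θ) = thetaResidue (h v w / θ) + thetaResidue (h v' w / θ) := by
    rw [haddl, add_div, thetaResidue_add (hdiv _ _) (hdiv _ _)]
  have hadd₂ (v w w' : L) :
      thetaResidue (h v (w + w') / θ) = thetaResidue (h v w / θ) + thetaResidue (h v w' / θ) := by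
    rw [haddr, add_div, thetaResidue_add (hdiv _ _) (hdiv _ _)]
  have hsmul₁ (u w : L) : h (θE • u) w = θ * h u w := hsmul θE u w
  have hsmul₂ (v u : L) : h v (θE • u) = θ * -h v u := by
    rw [hconj, hsmul₁, map_mul, conj_theta, ← hconj, neg_mul, mul_neg]
  refine ⟨⟨fun v w => thetaResidue (h v w / θ), ?_, ?_, ?_, hadd₁, hadd₂, ?_⟩, ?_⟩
  · intro v w e he
    obtain ⟨n, hn⟩ := exists_int_sub_mem e.2
    refine ⟨n, ?_, mem_thetaMultiples.1 hn⟩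
    simp only [he, mul_div_cancel_left₀ _ theta_ne_zero, thetaResidue_eq hn]
  · rintro _ v' w ⟨u, rfl⟩
    simp only [hadd₁]
    rw [hsmul₁, mul_div_cancel_left₀ _ theta_ne_zero, thetaResidue_of_mem (hmem _ _), add_zero]
  · rintro v _ w' ⟨u, rfl⟩
    simp only [hadd₂]
    rw [hsmul₂, mul_div_cancel_left₀ _ theta_ne_zero, thetaResidue_of_mem (neg_mem (hmem _ _)),
      add_zero]
  · intro v
    apply thetaResidue_of_conj_eq_neg (hdiv v v)
    rw [map_div₀, ← hconj, conj_theta, div_neg]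
  · intro f hf v hv
    have hcoord := coord_mem_thetaMultiples (v := v) fun j e he => by
      obtain ⟨n, hn, hm⟩ := hf v _ e he
      rw [hv] at hn
      simpa using add_mem (mem_thetaMultiples.2 hm) (intCast_mem_thetaMultiples.2 hn)
    choose u hu using fun i => mem_thetaMultiples.1 (hcoord i)
    exact ⟨u, funext fun i => Subtype.ext (hu i)⟩
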